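/- Let a : ℝ → ℝ be a Tauber-Wiener function, Y a Banach space, K₁ ⊂ Y compact, K₂ ⊂ ℝ^d compact, V ⊂ C(K₁) a compact set of continuous functions, and G : V → C(K₂) a continuous operator. Then for every ε > 0 there exist positive integers N, C, K, I, for each k = 1, …, K weights W_x^k ∈ ℝ^d and biases b_x^k ∈ ℝ, matrices W^k ∈ ℝ^{I×C}, biases b^k ∈ ℝ^I, coefficient vectors c^k ∈ ℝ^I, a compact set of admissible sensor configurations K_y ⊂ K₁^N, and a continuous map 𝒩 : K_y → ℝ^{C×N}, such that for all x ∈ K₂, all sensor configurations ŷ = (y₁, …, y_N) ∈ K_y, and all u ∈ V, |G(u)(x) − ∑_{k=1}^K a(W_x^k · x + b_x^k) · (c^k)^⊤ a(W^k 𝒩(ŷ) u(ŷ) + b^k)| < ε, where u(ŷ) = (u(y₁), …, u(y_N))^⊤ ∈ ℝ^N and a is applied entrywise to vectors. -/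

import Mathlib

/-- A function `a : ℝ → ℝ` is a Tauber-Wiener function if every continuous function on a
compact interval can be uniformly approximated by finite linear combinations
`∑ i, c i * a (λ i * x + θ i)`. -/
def IsTauberWiener (a : ℝ → ℝ) : Prop :=
  ∀ (s t : ℝ) (f : ℝ → ℝ), ContinuousOn f (Set.Icc s t) → ∀ ε : ℝ, 0 < ε →
    ∃ (N : ℕ), 0 < N ∧ ∃ (c lam θ : Fin N → ℝ),
      ∀ x ∈ Set.Icc s t, |f x - ∑ i, c i * a (lam i * x + θ i)| < ε

section

open Set Metric

/-- Configurations of `N` points whose closed `δ`-neighbourhoods cover the whole space. -/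
def denseSensors (X : Type*) [PseudoMetricSpace X] (δ : ℝ) (N : ℕ) : Set (Fin N → X) :=
  {y | ∀ x, ∃ n, dist x (y n) ≤ δ}

theorem isClosed_denseSensors (X : Type*) [PseudoMetricSpace X] (δ : ℝ) (N : ℕ) :
    IsClosed (denseSensors X δ N) := by
  have h : denseSensors X δ N = ⋂ x, ⋃ n, {y : Fin N → X | dist x (y n) ≤ δ} := by
    ext y
    simp [denseSensors]
  rw [h]
  exact isClosed_iInter fun x => isClosed_iUnion_of_finite fun n =>
    isClosed_le (by fun_prop) continuous_const

theorem exists_fin_net (X : Type*) [PseudoMetricSpace X] [CompactSpace X] {δ : ℝ} (hδ : 0 < δ) :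
    ∃ (n : ℕ) (p : Fin n → X), ∀ x, ∃ j, dist x (p j) < δ := by
  obtain ⟨t, -, ht, hcov⟩ := finite_cover_balls_of_compact (isCompact_univ (X := X)) hδ
  have : Fintype t := ht.fintype
  refine ⟨Fintype.card t, fun j => ((Fintype.equivFin t).symm j : X), fun x => ?_⟩
  obtain ⟨y, hy, hxy⟩ := mem_iUnion₂.1 (hcov (mem_univ x))
  exact ⟨Fintype.equivFin t ⟨y, hy⟩, by simpa using hxy⟩

theorem abs_weighted_average_sub_le {ι : Type*} [Fintype ι] {w t : ι → ℝ} {r η : ℝ}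
    (hw : ∀ i, 0 ≤ w i) (hS : 0 < ∑ i, w i) (h : ∀ i, 0 < w i → |t i - r| ≤ η) :
    |(∑ i, w i / (∑ j, w j) * t i) - r| ≤ η := by
  have hS' := hS.ne'
  have hsum : ∑ i, w i / (∑ j, w j) = 1 := by
    rw [← Finset.sum_div, div_self hS']
  calc |(∑ i, w i / (∑ j, w j) * t i) - r|
      = |∑ i, w i / (∑ j, w j) * (t i - r)| := by
        simp only [mul_sub, Finset.sum_sub_distrib, ← Finset.sum_mul, hsum, one_mul]
    _ ≤ ∑ i, |w i / (∑ j, w j) * (t i - r)| := Finset.abs_sum_le_sum_abs _ _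
    _ ≤ ∑ i, w i / (∑ j, w j) * η := by
        refine Finset.sum_le_sum fun i _ => ?_
        have h0 : 0 ≤ w i / ∑ j, w j := div_nonneg (hw i) hS.le
        rw [abs_mul, abs_of_nonneg h0]
        rcases (hw i).eq_or_lt with hi | hi
        · simp [← hi]
        · exact mul_le_mul_of_nonneg_left (h i hi) h0
    _ = η := by rw [← Finset.sum_mul, hsum, one_mul]

theorem IsCompact.exists_equicontinuity_modulus {X : Type*} [PseudoMetricSpace X] [CompactSpace X]
    {V : Set C(X, ℝ)} (hV : IsCompact V) {η : ℝ} (hη : 0 < η) :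
    ∃ δ > 0, ∀ u ∈ V, ∀ x y, dist x y < δ → |u x - u y| < η := by
  have : CompactSpace V := isCompact_iff_compactSpace.1 hV
  have hc : Continuous fun q : V × X => (q.1 : C(X, ℝ)) q.2 := by fun_prop
  obtain ⟨δ, hδ, h⟩ :=
    Metric.uniformContinuous_iff.1 (CompactSpace.uniformContinuous_of_continuous hc) η hη
  refine ⟨δ, hδ, fun u hu x y hxy => ?_⟩
  have := @h (⟨u, hu⟩, x) (⟨u, hu⟩, y) (by rw [Prod.dist_eq, dist_self]; exact max_lt hδ hxy)
  simpa [Real.dist_eq] using this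

/-- A continuous operator on a compact set of functions is, up to `ε`, a continuous function of
finitely many (possibly perturbed) point values. -/
theorem ContinuousOn.exists_approx_of_point_values {X Z : Type*} [PseudoMetricSpace X]
    [CompactSpace X] [Nonempty X] [TopologicalSpace Z] [CompactSpace Z] {V : Set C(X, ℝ)} (hV : IsCompact V)
    {G : C(X, ℝ) → C(Z, ℝ)} (hG : ContinuousOn G V) {ε : ℝ} (hε : 0 < ε) :
    ∃ η > 0, ∃ (n : ℕ) (_ : 0 < n) (p : Fin n → X) (H : C(Z × (Fin n → ℝ), ℝ)),
      ∀ u ∈ V, ∀ v : Fin n → ℝ, (∀ j, |v j - u (p j)| ≤ η) → ∀ z, |G u z - H (z, v)| ≤ ε := by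
  obtain ⟨ρ, hρ, hGρ⟩ :=
    Metric.uniformContinuousOn_iff.1 (hV.uniformContinuousOn_of_continuous hG) ε hε
  set η := ρ / 7 with hηdef
  have hη : 0 < η := by positivity
  obtain ⟨δ, hδ, hVδ⟩ := hV.exists_equicontinuity_modulus hη
  obtain ⟨n, p, hp⟩ := exists_fin_net X hδ
  have : CompactSpace V := isCompact_iff_compactSpace.1 hV
  obtain ⟨M, U, hU⟩ := exists_fin_net V hη
  let w : Fin M → (Fin n → ℝ) → ℝ := fun m v =>
    max 0 (3 * η - dist v fun j => (U m : C(X, ℝ)) (p j))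
  have hwc : ∀ m, Continuous (w m) := fun m => by fun_prop
  have hw0 : ∀ m v, 0 ≤ w m v := fun m v => le_max_left _ _
  have hden : ∀ v, max η (∑ k, w k v) ≠ 0 := fun v => (lt_max_of_lt_left hη).ne'
  let H : C(Z × (Fin n → ℝ), ℝ) :=
    ⟨fun q => ∑ m, w m q.2 / max η (∑ k, w k q.2) * G (U m) q.1, by
      refine continuous_finsetSum _ fun m _ => ?_
      refine (Continuous.div ((hwc m).comp continuous_snd) ?_ fun q => hden q.2).mul
        ((G (U m)).continuous.comp continuous_fst)
      exact continuous_const.max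
        (continuous_finsetSum _ fun k _ => (hwc k).comp continuous_snd)⟩
  refine ⟨η, hη, n, (hp (Classical.arbitrary X)).choose.pos, p, H, fun u hu v hv z => ?_⟩
  have hvu : dist v (fun j => u (p j)) ≤ η :=
    (dist_pi_le_iff hη.le).2 fun j => by simpa [Real.dist_eq] using hv j
  obtain ⟨m₀, hm₀⟩ := hU ⟨u, hu⟩
  have hm₀' : dist u (U m₀ : C(X, ℝ)) < η := hm₀
  have hS : η ≤ ∑ k, w k v := by
    have h1 : dist (fun j => u (p j)) (fun j => (U m₀ : C(X, ℝ)) (p j)) ≤ η :=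
      (dist_pi_le_iff hη.le).2 fun j => (ContinuousMap.dist_apply_le_dist _).trans hm₀'.le
    have h2 : η ≤ w m₀ v := by
      refine le_max_of_le_right ?_
      linarith [dist_triangle v (fun j => u (p j)) (fun j => (U m₀ : C(X, ℝ)) (p j))]
    exact h2.trans (Finset.single_le_sum (fun k _ => hw0 k v) (Finset.mem_univ m₀))
  have hclose : ∀ m, 0 < w m v → |G (U m) z - G u z| ≤ ε := by
    intro m hm
    have h1 : dist v (fun j => (U m : C(X, ℝ)) (p j)) < 3 * η := by
      rcases lt_max_iff.1 hm with h | h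
      · exact absurd h (lt_irrefl _)
      · linarith
    have h2 : dist (U m : C(X, ℝ)) u ≤ 6 * η := by
      refine (ContinuousMap.dist_le (by positivity)).2 fun x => ?_
      obtain ⟨j, hj⟩ := hp x
      have e1 := abs_lt.1 (hVδ _ (U m).2 x (p j) hj)
      have e2 := abs_lt.1 (hVδ u hu x (p j) hj)
      have e3 := abs_le.1 (hv j)
      have e4 := abs_lt.1 ((Real.dist_eq _ _) ▸ (dist_le_pi_dist _ _ j).trans_lt h1)
      rw [Real.dist_eq, abs_le]
      constructor <;> linarith
    have h3 := hGρ _ (U m).2 u hu (h2.trans_lt (by linarith))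
    rw [← Real.dist_eq]
    exact (ContinuousMap.dist_apply_le_dist z).trans h3.le
  have key := abs_weighted_average_sub_le (w := fun m => w m v) (t := fun m => G (U m) z)
    (fun m => hw0 m v) (hη.trans_le hS) hclose
  rw [abs_sub_comm]
  simpa only [H, ContinuousMap.coe_mk, max_eq_right hS] using key

/-- The span of products of one neuron in each of two vector variables. -/
def neuronProductSpan (a : ℝ → ℝ) (d m : ℕ) :
    Submodule ℝ ((Fin d → ℝ) × (Fin m → ℝ) → ℝ) :=
  Submodule.span ℝ (range fun (q : ((Fin d → ℝ) × ℝ) × ((Fin m → ℝ) × ℝ)) z =>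
    a (q.1.1 ⬝ᵥ z.1 + q.1.2) * a (q.2.1 ⬝ᵥ z.2 + q.2.2))

theorem IsTauberWiener.exists_approx_exp_mul_exp {a : ℝ → ℝ} (ha : IsTauberWiener a) {d m : ℕ}
    {K : Set (Fin d → ℝ)} (hK : IsCompact K) {L : Set (Fin m → ℝ)} (hL : IsCompact L)
    (w : Fin d → ℝ) (w' : Fin m → ℝ) {δ : ℝ} (hδ : 0 < δ) :
    ∃ g ∈ neuronProductSpan a d m, ∀ x ∈ K, ∀ v ∈ L,
      |Real.exp (w ⬝ᵥ x) * Real.exp (w' ⬝ᵥ v) - g (x, v)| < δ := by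
  obtain ⟨r₁, hr₁⟩ := hK.exists_bound_of_continuousOn (f := fun x => w ⬝ᵥ x)
    (Continuous.dotProduct continuous_const continuous_id).continuousOn
  obtain ⟨r₂, hr₂⟩ := hL.exists_bound_of_continuousOn (f := fun x => w' ⬝ᵥ x)
    (Continuous.dotProduct continuous_const continuous_id).continuousOn
  set r := max r₁ r₂
  set E := Real.exp r
  have hE : 0 < E := Real.exp_pos r
  set η := min 1 (δ / (2 * E + 1))
  have hη : 0 < η := lt_min one_pos (by positivity)
  have hη1 : η ≤ 1 := min_le_left _ _
  have hηδ : η * (2 * E + 1) ≤ δ := (le_div_iff₀ (by positivity)).1 (min_le_right _ _)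
  obtain ⟨N, -, c, lam, θ, hT⟩ := ha (-r) r Real.exp Real.continuous_exp.continuousOn η hη
  set T : ℝ → ℝ := fun s => ∑ i, c i * a (lam i * s + θ i)
  refine ⟨fun z => T (w ⬝ᵥ z.1) * T (w' ⬝ᵥ z.2), ?_, fun x hx v hv => ?_⟩
  · have h : (fun z : (Fin d → ℝ) × (Fin m → ℝ) => T (w ⬝ᵥ z.1) * T (w' ⬝ᵥ z.2)) =
        ∑ i, ∑ j, (c i * c j) • fun z : (Fin d → ℝ) × (Fin m → ℝ) =>
          a ((lam i • w) ⬝ᵥ z.1 + θ i) * a ((lam j • w') ⬝ᵥ z.2 + θ j) := by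
      funext z
      simp only [T, Finset.sum_mul_sum, Finset.sum_apply, Pi.smul_apply, smul_dotProduct,
        smul_eq_mul]
      exact Finset.sum_congr rfl fun i _ => Finset.sum_congr rfl fun j _ => by ring
    rw [h]
    exact Submodule.sum_mem _ fun i _ => Submodule.sum_mem _ fun j _ =>
      Submodule.smul_mem _ _ (Submodule.subset_span ⟨((lam i • w, θ i), (lam j • w', θ j)), rfl⟩)
  · have hx' := abs_le.1 ((hr₁ x hx).trans (le_max_left r₁ r₂))
    have hv' := abs_le.1 ((hr₂ v hv).trans (le_max_right r₁ r₂))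
    have h1 := hT _ hx'
    have h2 := hT _ hv'
    have hxE : Real.exp (w ⬝ᵥ x) ≤ E := Real.exp_le_exp.2 hx'.2
    have hvE : Real.exp (w' ⬝ᵥ v) ≤ E := Real.exp_le_exp.2 hv'.2
    change |Real.exp (w ⬝ᵥ x) * Real.exp (w' ⬝ᵥ v) - T (w ⬝ᵥ x) * T (w' ⬝ᵥ v)| < δ
    change |Real.exp (w ⬝ᵥ x) - T (w ⬝ᵥ x)| < η at h1
    change |Real.exp (w' ⬝ᵥ v) - T (w' ⬝ᵥ v)| < η at h2
    have hpx := Real.exp_pos (w ⬝ᵥ x)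
    have hpv := Real.exp_pos (w' ⬝ᵥ v)
    generalize Real.exp (w ⬝ᵥ x) = e at *
    generalize Real.exp (w' ⬝ᵥ v) = e' at *
    generalize T (w ⬝ᵥ x) = t at *
    generalize T (w' ⬝ᵥ v) = t' at *
    have ht : |t| ≤ E + 1 := by
      rw [abs_le]
      constructor <;> linarith [(abs_lt.1 h1).1, (abs_lt.1 h1).2]
    calc |e * e' - t * t'| = |(e - t) * e' + t * (e' - t')| := by ring_nf
      _ ≤ |e - t| * e' + |t| * |e' - t'| := by
        refine (abs_add_le _ _).trans ?_
        rw [abs_mul, abs_mul, abs_of_pos hpv]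
      _ < η * E + (E + 1) * η :=
        add_lt_add_of_lt_of_le
          ((mul_lt_mul_of_pos_right h1 hpv).trans_le (mul_le_mul_of_nonneg_left hvE hη.le))
          (mul_le_mul ht h2.le (abs_nonneg _) (by positivity))
      _ = η * (2 * E + 1) := by ring
      _ ≤ δ := hηδ

theorem IsTauberWiener.exists_approx_continuousMap {a : ℝ → ℝ} (ha : IsTauberWiener a) {d m : ℕ}
    {K : Set (Fin d → ℝ)} (hK : IsCompact K) {L : Set (Fin m → ℝ)} (hL : IsCompact L)
    (f : C(K × L, ℝ)) {δ : ℝ} (hδ : 0 < δ) :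
    ∃ g ∈ neuronProductSpan a d m, ∀ (x : K) (v : L), |f (x, v) - g (x, v)| < δ := by
  have : CompactSpace K := isCompact_iff_compactSpace.1 hK
  have : CompactSpace L := isCompact_iff_compactSpace.1 hL
  let e : (Fin d → ℝ) × (Fin m → ℝ) → C(K × L, ℝ) := fun q =>
    ⟨fun z => Real.exp (q.1 ⬝ᵥ (z.1 : Fin d → ℝ)) * Real.exp (q.2 ⬝ᵥ (z.2 : Fin m → ℝ)), by
      refine (Real.continuous_exp.comp ?_).mul (Real.continuous_exp.comp ?_)
      · exact continuous_const.dotProduct (continuous_subtype_val.comp continuous_fst)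
      · exact continuous_const.dotProduct (continuous_subtype_val.comp continuous_snd)⟩
  let S : Submonoid C(K × L, ℝ) :=
    { carrier := range e
      one_mem' := ⟨0, by ext z; simp [e]⟩
      mul_mem' := by
        rintro _ _ ⟨q, rfl⟩ ⟨q', rfl⟩
        refine ⟨q + q', ?_⟩
        ext z
        simp only [e, ContinuousMap.coe_mk, ContinuousMap.mul_apply, Prod.fst_add, Prod.snd_add,
          add_dotProduct, Real.exp_add]
        ring }
  have hsep : (Algebra.adjoin ℝ (S : Set C(K × L, ℝ))).SeparatesPoints := by
    intro z z' hne
    obtain ⟨q, hq⟩ : ∃ q, e q z ≠ e q z' := by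
      by_contra! hcon
      refine hne (Prod.ext (Subtype.ext (funext fun i => ?_)) (Subtype.ext (funext fun i => ?_)))
      · simpa [e] using hcon (Pi.single i 1, 0)
      · simpa [e] using hcon (0, Pi.single i 1)
    exact ⟨e q, ⟨e q, Algebra.subset_adjoin ⟨q, rfl⟩, rfl⟩, hq⟩
  obtain ⟨⟨h, hmem⟩, hh⟩ := ContinuousMap.exists_mem_subalgebra_near_continuousMap_of_separatesPoints
    _ hsep f (δ / 2) (half_pos hδ)
  have hspan : h ∈ Submodule.span ℝ (range e) := by
    have : h ∈ Subalgebra.toSubmodule (Algebra.adjoin ℝ (S : Set C(K × L, ℝ))) := hmem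
    rwa [Algebra.adjoin_eq_span, Submonoid.closure_eq] at this
  have happrox : ∀ η : ℝ, 0 < η →
      ∃ g ∈ neuronProductSpan a d m, ∀ (x : K) (v : L), |h (x, v) - g (x, v)| < η := by
    clear hh hmem
    induction hspan using Submodule.span_induction with
    | mem h hh =>
      obtain ⟨q, rfl⟩ := hh
      intro η hη
      obtain ⟨g, hg, hg'⟩ := ha.exists_approx_exp_mul_exp hK hL q.1 q.2 hη
      exact ⟨g, hg, fun x v => hg' x x.2 v v.2⟩
    | zero => exact fun η hη => ⟨0, Submodule.zero_mem _, by simpa using fun _ _ _ _ => hη⟩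
    | add h₁ h₂ _ _ ih₁ ih₂ =>
      intro η hη
      obtain ⟨g₁, hg₁, hg₁'⟩ := ih₁ (η / 2) (half_pos hη)
      obtain ⟨g₂, hg₂, hg₂'⟩ := ih₂ (η / 2) (half_pos hη)
      refine ⟨g₁ + g₂, Submodule.add_mem _ hg₁ hg₂, fun x v => ?_⟩
      have e₁ := abs_lt.1 (hg₁' x v)
      have e₂ := abs_lt.1 (hg₂' x v)
      simp only [ContinuousMap.add_apply, Pi.add_apply]
      rw [abs_lt]
      constructor <;> linarith
    | smul c h _ ih =>
      intro η hη
      have hc : 0 < |c| + 1 := by positivity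
      obtain ⟨g, hg, hg'⟩ := ih (η / (|c| + 1)) (div_pos hη hc)
      refine ⟨c • g, Submodule.smul_mem _ _ hg, fun x v => ?_⟩
      have h1 := (lt_div_iff₀ hc).1 (hg' x v)
      simp only [ContinuousMap.smul_apply, Pi.smul_apply, smul_eq_mul, ← mul_sub, abs_mul]
      nlinarith [abs_nonneg (h (x, v) - g (x, v))]
  obtain ⟨g, hg, hg'⟩ := happrox (δ / 2) (half_pos hδ)
  refine ⟨g, hg, fun x v => ?_⟩
  have h1 := abs_lt.1 ((ContinuousMap.norm_coe_le_norm _ (x, v)).trans_lt hh)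
  have h2 := abs_lt.1 (hg' x v)
  simp only [ContinuousMap.sub_apply] at h1
  rw [abs_lt]
  constructor <;> linarith

theorem exists_sum_eq_of_mem_neuronProductSpan {a : ℝ → ℝ} {d m : ℕ}
    {g : (Fin d → ℝ) × (Fin m → ℝ) → ℝ} (hg : g ∈ neuronProductSpan a d m) :
    ∃ (K : ℕ) (_ : 0 < K) (c : Fin K → ℝ) (q : Fin K → ((Fin d → ℝ) × ℝ) × ((Fin m → ℝ) × ℝ)),
      ∀ z, g z = ∑ k, c k *
        (a ((q k).1.1 ⬝ᵥ z.1 + (q k).1.2) * a ((q k).2.1 ⬝ᵥ z.2 + (q k).2.2)) := by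
  obtain ⟨n, c, s, rfl⟩ := Submodule.mem_span_set'.1 hg
  choose q hq using fun i => (s i).2
  refine ⟨n + 1, n.succ_pos, Fin.cons 0 c, Fin.cons 0 q, fun z => ?_⟩
  simp [Fin.sum_univ_succ, ← hq]

/-- BelNet approximation with all the weights independent of the number `N` of sensors and of
their positions, the only requirement being that the sensors are `δ`-dense. -/
theorem IsTauberWiener.exists_belnet_approx {X : Type*} [PseudoMetricSpace X] [CompactSpace X]
    [Nonempty X] {d : ℕ} {a : ℝ → ℝ} (ha : IsTauberWiener a) {K₂ : Set (Fin d → ℝ)}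
    (hK₂ : IsCompact K₂) {V : Set C(X, ℝ)} (hV : IsCompact V) {G : C(X, ℝ) → C(K₂, ℝ)}
    (hG : ContinuousOn G V) {ε : ℝ} (hε : 0 < ε) :
    ∃ (δ : ℝ) (Cn K : ℕ), 0 < δ ∧ 0 < Cn ∧ 0 < K ∧
      ∃ (Wx : Fin K → Fin d → ℝ) (bx : Fin K → ℝ) (W : Fin K → Matrix (Fin 1) (Fin Cn) ℝ)
        (b : Fin K → Fin 1 → ℝ) (c : Fin K → Fin 1 → ℝ), ∀ N : ℕ,
      ∃ Net : (Fin N → X) → Matrix (Fin Cn) (Fin N) ℝ, ContinuousOn Net (denseSensors X δ N) ∧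
        ∀ x : K₂, ∀ yv ∈ denseSensors X δ N, ∀ u ∈ V,
          |G u x - ∑ k, a ((∑ j, Wx k j * (x : Fin d → ℝ) j) + bx k) *
              ∑ i, c k i *
                a ((W k).mulVec ((Net yv).mulVec (fun j => u (yv j))) i + b k i)| < ε := by
  have : CompactSpace K₂ := isCompact_iff_compactSpace.1 hK₂
  obtain ⟨η, hη, n, hn, p, H, hH⟩ := hG.exists_approx_of_point_values hV (half_pos hε)
  obtain ⟨δ', hδ', hVδ⟩ := hV.exists_equicontinuity_modulus hη
  obtain ⟨R, hR⟩ := hV.isBounded.exists_norm_le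
  obtain ⟨g, hg, hgH⟩ := ha.exists_approx_continuousMap hK₂
    (isCompact_closedBall (0 : Fin n → ℝ) (R + η))
    ⟨fun z => H (z.1, z.2), by fun_prop⟩ (half_pos hε)
  obtain ⟨K, hK, c, q, hq⟩ := exists_sum_eq_of_mem_neuronProductSpan hg
  refine ⟨δ' / 2, n, K, half_pos hδ', hn, hK, fun k => (q k).1.1, fun k => (q k).1.2,
    fun k _ => (q k).2.1, fun k _ => (q k).2.2, fun k _ => c k, fun N => ?_⟩
  let w : (Fin N → X) → Fin n → Fin N → ℝ := fun y j i => max 0 (δ' - dist (p j) (y i))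
  have hw0 : ∀ y j i, 0 ≤ w y j i := fun y j i => le_max_left _ _
  have hwS : ∀ y ∈ denseSensors X (δ' / 2) N, ∀ j, 0 < ∑ i, w y j i := by
    intro y hy j
    obtain ⟨i, hi⟩ := hy (p j)
    exact Finset.sum_pos' (fun i _ => hw0 y j i)
      ⟨i, Finset.mem_univ i, lt_max_of_lt_right (by linarith)⟩
  refine ⟨fun y j i => w y j i / ∑ k, w y j k, ?_, fun x y hy u hu => ?_⟩
  · refine continuousOn_pi.2 fun j => continuousOn_pi.2 fun i => ContinuousOn.div ?_ ?_
      fun y hy => (hwS y hy j).ne'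
    · exact Continuous.continuousOn (by fun_prop)
    · exact Continuous.continuousOn (by fun_prop)
  · set v : Fin n → ℝ := Matrix.mulVec (fun j i => w y j i / ∑ k, w y j k) fun i => u (y i)
    have hv : ∀ j, |v j - u (p j)| ≤ η := fun j =>
      abs_weighted_average_sub_le (hw0 y j) (hwS y hy j) fun i hi => by
        rcases lt_max_iff.1 hi with h | h
        · exact absurd h (lt_irrefl _)
        · exact (hVδ u hu _ _ (by rw [dist_comm]; linarith)).le
    have hR0 : 0 ≤ R := (norm_nonneg u).trans (hR u hu)
    have hvL : v ∈ closedBall (0 : Fin n → ℝ) (R + η) := by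
      refine mem_closedBall_zero_iff.2 ((pi_norm_le_iff_of_nonneg (by positivity)).2 fun j => ?_)
      have h1 := abs_le.1 (hv j)
      have h2 := abs_le.1 ((u.norm_coe_le_norm (p j)).trans (hR u hu))
      rw [Real.norm_eq_abs, abs_le]
      constructor <;> linarith
    have h1 := abs_le.1 (hH u hu v hv x)
    have h2 := abs_lt.1 (hgH x ⟨v, hvL⟩)
    simp only [ContinuousMap.coe_mk] at h2
    have h3 : g (x, v) = ∑ k, a ((∑ j, (q k).1.1 j * (x : Fin d → ℝ) j) + (q k).1.2) *
        ∑ i : Fin 1, c k * a (Matrix.mulVec (fun _ : Fin 1 => (q k).2.1) v i + (q k).2.2) := by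
      rw [hq]
      refine Finset.sum_congr rfl fun k _ => ?_
      simp only [Finset.univ_unique, Finset.sum_singleton, Matrix.mulVec, dotProduct]
      ring
    rw [← h3, abs_lt]
    constructor <;> linarith

end

/-- Discretization-invariance theorem for BelNet: the same network approximates `G(u)(x)`
uniformly over all sensor configurations `yv = (y₁, …, y_N)` in a compact admissible set
`K_y ⊂ K₁^N`, with `Net : K_y → ℝ^{C×N}` a continuous (trainable) map, the activation `a`
applied entrywise. -/
theorem belnet_discretization_invariance
    {Y : Type*} [NormedAddCommGroup Y] [NormedSpace ℝ Y] [CompleteSpace Y]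
    {d : ℕ} (a : ℝ → ℝ) (ha : IsTauberWiener a)
    (K₁ : Set Y) (hK₁ : IsCompact K₁)
    (K₂ : Set (Fin d → ℝ)) (hK₂ : IsCompact K₂)
    (V : Set C(↥K₁, ℝ)) (hV : IsCompact V)
    (G : C(↥K₁, ℝ) → C(↥K₂, ℝ)) (hG : ContinuousOn G V)
    (ε : ℝ) (hε : 0 < ε) :
    ∃ (N Cn K I : ℕ), 0 < N ∧ 0 < Cn ∧ 0 < K ∧ 0 < I ∧
      ∃ (Wx : Fin K → Fin d → ℝ) (bx : Fin K → ℝ)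
        (W : Fin K → Matrix (Fin I) (Fin Cn) ℝ)
        (b : Fin K → Fin I → ℝ) (c : Fin K → Fin I → ℝ)
        (Ky : Set (Fin N → ↥K₁)), IsCompact Ky ∧
      ∃ (Net : (Fin N → ↥K₁) → Matrix (Fin Cn) (Fin N) ℝ), ContinuousOn Net Ky ∧
        ∀ x : ↥K₂, ∀ yv ∈ Ky, ∀ u ∈ V,
          |G u x -
              ∑ k, a ((∑ j, Wx k j * (x : Fin d → ℝ) j) + bx k) *
                ∑ i, c k i *
                  a ((W k).mulVec ((Net yv).mulVec (fun j => u (yv j))) i + b k i)| < ε := by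
  have : CompactSpace K₁ := isCompact_iff_compactSpace.1 hK₁
  rcases isEmpty_or_nonempty K₁ with hempty | hne
  · exact ⟨1, 1, 1, 1, one_pos, one_pos, one_pos, one_pos, 0, 0, 0, 0, 0, ∅, isCompact_empty, 0,
      continuousOn_empty _, fun _ _ h => absurd h (Set.notMem_empty _)⟩
  · obtain ⟨δ, Cn, K, hδ, hCn, hK, Wx, bx, W, b, c, h⟩ := ha.exists_belnet_approx hK₂ hV hG hε
    obtain ⟨N, y, hy⟩ := exists_fin_net K₁ hδ
    obtain ⟨Net, hNet, happrox⟩ := h N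
    exact ⟨N, Cn, K, 1, (hy (Classical.arbitrary K₁)).choose.pos, hCn, hK, one_pos, Wx, bx, W, b, c,
      denseSensors K₁ δ N, (isClosed_denseSensors K₁ δ N).isCompact, Net, hNet, happrox⟩
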